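/- arXiv:2407.20677 — 6 statements merged into one kernel-verified Lean document; each statement's English description precedes it below -/
import Mathlib

section
/- Let N, K, n be natural numbers with K ≤ N, n ≤ N, and n = N − K. Then for every complex number z, the probability-generating function of the hypergeometric distribution satisfies ∑_{k=0}^{n} (C(K,k)·C(N−K,n−k)/C(N,n))·z^k = (n!·K!)/N! · ∑_{j=0}^{min(n,K)} ((−n)_j·(−K)_j)/(j!)^2 · z^j; in particular, both branches of the generating-function formula (the one valid for n ≤ N−K and the one valid for n ≥ N−K+1 extended to n = N−K) take this common value at n = N − K. -/
open Finset Nat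

/-- The rising factorial at a negated natural number is a signed falling factorial. -/
lemma ascPochhammer_eval_neg_natCast {R : Type*} [Ring R] (m j : ℕ) :
    (ascPochhammer R j).eval (-(m : R)) = (-1) ^ j * (m.descFactorial j : R) := by
  rw [ascPochhammer_eval_neg_eq_descPochhammer, descPochhammer_eval_eq_descFactorial]

lemma ascPochhammer_eval_neg_mul_div_factorial_sq (n K j : ℕ) :
    ((ascPochhammer ℂ j).eval (-(n : ℂ)) * (ascPochhammer ℂ j).eval (-(K : ℂ))) /
      ((j ! : ℂ) ^ 2) = (n.choose j : ℂ) * (K.choose j : ℂ) := by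
  have hj : (j ! : ℂ) ≠ 0 := by exact_mod_cast Nat.factorial_ne_zero j
  have hs : ((-1 : ℂ) ^ j) * (-1) ^ j = 1 := by rw [← mul_pow]; simp
  rw [ascPochhammer_eval_neg_natCast, ascPochhammer_eval_neg_natCast,
    Nat.descFactorial_eq_factorial_mul_choose, Nat.descFactorial_eq_factorial_mul_choose]
  push_cast
  rw [div_eq_iff (pow_ne_zero 2 hj)]
  linear_combination (j ! : ℂ) ^ 2 * n.choose j * K.choose j * hs

theorem hypergeometric_pgf_overlap (N K n : ℕ) (hKN : K ≤ N) (hnN : n ≤ N)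
    (hn : n = N - K) (z : ℂ) :
    (∑ k ∈ Finset.range (n + 1),
        ((K.choose k : ℂ) * ((N - K).choose (n - k) : ℂ) / (N.choose n : ℂ)) * z ^ k
      = (n ! : ℂ) * (K ! : ℂ) / (N ! : ℂ) *
        ∑ j ∈ Finset.range (min n K + 1),
          ((ascPochhammer ℂ j).eval (-(n : ℂ)) * (ascPochhammer ℂ j).eval (-(K : ℂ))) /
            ((j ! : ℂ) ^ 2) * z ^ j) ∧
    (((N - n)! : ℂ) * ((N - K)! : ℂ) / ((N ! : ℂ) * ((N - K - n)! : ℂ)) *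
        ∑ j ∈ Finset.range (min n K + 1),
          ((ascPochhammer ℂ j).eval (-(n : ℂ)) * (ascPochhammer ℂ j).eval (-(K : ℂ))) /
            ((ascPochhammer ℂ j).eval ((N : ℂ) - (K : ℂ) - (n : ℂ) + 1) * (j ! : ℂ)) * z ^ j
      = (n ! : ℂ) * (K ! : ℂ) / (N ! : ℂ) *
        ∑ j ∈ Finset.range (min n K + 1),
          ((ascPochhammer ℂ j).eval (-(n : ℂ)) * (ascPochhammer ℂ j).eval (-(K : ℂ))) /
            ((j ! : ℂ) ^ 2) * z ^ j) ∧
    ((n ! : ℂ) * (K ! : ℂ) / ((N ! : ℂ) * ((n + K - N)! : ℂ)) * z ^ (n + K - N) *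
        ∑ j ∈ Finset.range (min (N - n) (N - K) + 1),
          ((ascPochhammer ℂ j).eval ((n : ℂ) - (N : ℂ)) *
              (ascPochhammer ℂ j).eval ((K : ℂ) - (N : ℂ))) /
            ((ascPochhammer ℂ j).eval ((n : ℂ) + (K : ℂ) - (N : ℂ) + 1) * (j ! : ℂ)) * z ^ j
      = (n ! : ℂ) * (K ! : ℂ) / (N ! : ℂ) *
        ∑ j ∈ Finset.range (min n K + 1),
          ((ascPochhammer ℂ j).eval (-(n : ℂ)) * (ascPochhammer ℂ j).eval (-(K : ℂ))) /
            ((j ! : ℂ) ^ 2) * z ^ j) := by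
  obtain rfl : N = n + K := by omega
  have h1 : n + K - K = n := by omega
  have h2 : n + K - n = K := by omega
  have e1 : ((n + K : ℕ) : ℂ) - K - n + 1 = 1 := by push_cast; ring
  have e2 : (n : ℂ) + K - ((n + K : ℕ) : ℂ) + 1 = 1 := by push_cast; ring
  have e3 : (n : ℂ) - ((n + K : ℕ) : ℂ) = -(K : ℂ) := by push_cast; ring
  have e4 : (K : ℂ) - ((n + K : ℕ) : ℂ) = -(n : ℂ) := by push_cast; ring
  rw [h1, h2, e1, e2, e3, e4, Nat.sub_self, Nat.sub_self, min_comm K n]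
  simp only [ascPochhammer_eval_one, Nat.factorial_zero, Nat.cast_one, mul_one,
    pow_zero, ← pow_two]
  refine ⟨?_, ?_, ?_⟩
  · simp only [ascPochhammer_eval_neg_mul_div_factorial_sq]
    have hsub : Finset.range (min n K + 1) ⊆ Finset.range (n + 1) :=
      Finset.range_subset_range.2 (by omega)
    rw [Finset.mul_sum, Finset.sum_subset hsub]
    · refine Finset.sum_congr rfl fun k hk => ?_
      have hn0 : (n ! : ℂ) ≠ 0 := by exact_mod_cast Nat.factorial_ne_zero n
      have hK0 : (K ! : ℂ) ≠ 0 := by exact_mod_cast Nat.factorial_ne_zero K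
      have hN0 : ((n + K)! : ℂ) ≠ 0 := by exact_mod_cast Nat.factorial_ne_zero (n + K)
      rw [Nat.choose_symm (Nat.lt_succ_iff.1 (Finset.mem_range.1 hk)), Nat.cast_add_choose]
      field_simp
    · intro k hk hk'
      rw [Finset.mem_range] at hk hk'
      rw [Nat.choose_eq_zero_of_lt (show K < k by omega)]
      simp
  · rw [mul_comm (K ! : ℂ)]
  · simp only [mul_comm ((ascPochhammer ℂ _).eval (-(K : ℂ)))]
end

section
/- Let N, K, n be natural numbers with K ≤ N, n ≤ N, and n ≥ N − K + 1. Then for every real number t, the moment-generating function of the hypergeometric distribution satisfies ∑_{k=0}^{n} (C(K,k)·C(N−K,n−k)/C(N,n))·e^{t·k} = (n!·K!)/(N!·(n+K−N)!) · e^{t·(n+K−N)} · ∑_{j=0}^{min(N−n,N−K)} ((n−N)_j·(K−N)_j)/((n+K−N+1)_j · j!) · e^{t·j}. -/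
open Finset Nat

/-- The Pochhammer symbol `(-a)_j` as a signed quotient of factorials. -/
lemma ascPochhammer_eval_neg_natCast_s4 {a j : ℕ} (h : j ≤ a) :
    (ascPochhammer ℝ j).eval (-(a : ℝ)) = (-1) ^ j * ((a ! : ℝ) / ((a - j)! : ℝ)) := by
  rw [ascPochhammer_eval_neg_eq_descPochhammer, descPochhammer_eval_eq_descFactorial]
  congr 1
  rw [eq_div_iff (Nat.cast_ne_zero.mpr (Nat.factorial_ne_zero _)), mul_comm]
  exact_mod_cast Nat.factorial_mul_descFactorial h

/-- The Pochhammer symbol `(m + 1)_j` as a quotient of factorials. -/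
lemma ascPochhammer_eval_natCast_add_one (m j : ℕ) :
    (ascPochhammer ℝ j).eval ((m : ℝ) + 1) = ((m + j)! : ℝ) / (m ! : ℝ) := by
  rw [eq_div_iff (Nat.cast_ne_zero.mpr (Nat.factorial_ne_zero _)), mul_comm]
  exact factorial_mul_ascPochhammer ℝ m j

/-- A hypergeometric weight at distance `j` above the lowest point `m` of its support, as a
hypergeometric series coefficient. -/
lemma hypergeometric_weight_eq (m a b j : ℕ) (ha : j ≤ a) (hb : j ≤ b) :
    ((m + a).choose (m + j) : ℝ) * (b.choose (b - j) : ℝ) / ((m + a + b).choose (m + b) : ℝ) =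
      ((m + b)! : ℝ) * ((m + a)! : ℝ) / (((m + a + b)! : ℝ) * (m ! : ℝ)) *
        ((ascPochhammer ℝ j).eval (-(a : ℝ)) * (ascPochhammer ℝ j).eval (-(b : ℝ)) /
          ((ascPochhammer ℝ j).eval ((m : ℝ) + 1) * (j ! : ℝ))) := by
  rw [ascPochhammer_eval_neg_natCast_s4 ha, ascPochhammer_eval_neg_natCast_s4 hb,
    ascPochhammer_eval_natCast_add_one, Nat.choose_symm hb,
    Nat.cast_choose ℝ (by lia : m + j ≤ m + a), Nat.cast_choose ℝ hb,
    Nat.cast_choose ℝ (by lia : m + b ≤ m + a + b),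
    show m + a - (m + j) = a - j by lia, show m + a + b - (m + b) = a by lia]
  have hf (i : ℕ) : (i ! : ℝ) ≠ 0 := Nat.cast_ne_zero.mpr (Nat.factorial_ne_zero i)
  have hs : ((-1 : ℝ) ^ j) ^ 2 = 1 := by rw [← pow_mul, mul_comm, pow_mul]; norm_num
  have h1 := hf (m + a)
  have h2 := hf (m + b)
  have h3 := hf (m + j)
  have h4 := hf (m + a + b)
  have h5 := hf (a - j)
  have h6 := hf (b - j)
  have h7 := hf a
  have h8 := hf b
  have h9 := hf j
  have h10 := hf m
  field_simp
  rw [hs]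

theorem hypergeometric_mgf_corrected_branch (N K n : ℕ) (hKN : K ≤ N) (hnN : n ≤ N)
    (hn : N - K + 1 ≤ n) (t : ℝ) :
    ∑ k ∈ Finset.range (n + 1),
        ((K.choose k : ℝ) * ((N - K).choose (n - k) : ℝ) / (N.choose n : ℝ)) *
          Real.exp (t * k)
    = (n ! : ℝ) * (K ! : ℝ) / ((N ! : ℝ) * ((n + K - N)! : ℝ)) *
        Real.exp (t * (n + K - N : ℕ)) *
      ∑ j ∈ Finset.range (min (N - n) (N - K) + 1),
        ((ascPochhammer ℝ j).eval ((n : ℝ) - (N : ℝ)) *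
            (ascPochhammer ℝ j).eval ((K : ℝ) - (N : ℝ))) /
          ((ascPochhammer ℝ j).eval ((n : ℝ) + (K : ℝ) - (N : ℝ) + 1) * (j ! : ℝ)) *
          Real.exp (t * j) := by
  obtain ⟨m, a, b, rfl, rfl, rfl⟩ : ∃ m a b, n = m + b ∧ K = m + a ∧ N = m + a + b :=
    ⟨n + K - N, N - n, N - K, by lia, by lia, by lia⟩
  rw [show m + a + b - (m + a) = b by lia, show m + a + b - (m + b) = a by lia,
    show m + b + (m + a) - (m + a + b) = m by lia,
    show ((m + b : ℕ) : ℝ) - ((m + a + b : ℕ) : ℝ) = -(a : ℝ) by push_cast; ring,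
    show ((m + a : ℕ) : ℝ) - ((m + a + b : ℕ) : ℝ) = -(b : ℝ) by push_cast; ring,
    show ((m + b : ℕ) : ℝ) + ((m + a : ℕ) : ℝ) - ((m + a + b : ℕ) : ℝ) = (m : ℝ) by
      push_cast; ring,
    add_assoc m b 1, Finset.sum_range_add, Finset.sum_eq_zero, zero_add, Finset.mul_sum]
  · symm
    refine Finset.sum_subset_zero_on_sdiff (Finset.range_mono (by lia)) ?_ ?_
    · intro j hj
      simp only [Finset.mem_sdiff, Finset.mem_range] at hj
      rw [Nat.choose_eq_zero_of_lt (by lia : m + a < m + j)]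
      simp
    · intro j hj
      rw [Finset.mem_range] at hj
      rw [show m + b - (m + j) = b - j by lia,
        hypergeometric_weight_eq m a b j (by lia) (by lia), Nat.cast_add, mul_add, Real.exp_add]
      ring
  · intro k hk
    rw [Finset.mem_range] at hk
    rw [Nat.choose_eq_zero_of_lt (by lia : b < m + b - k)]
    simp
end

section
/- Let N, K, n be natural numbers with K ≤ N, n ≤ N, and n ≥ N − K + 1, and let i denote the imaginary unit. Then for every real number t, the characteristic function of the hypergeometric distribution satisfies ∑_{k=0}^{n} (C(K,k)·C(N−K,n−k)/C(N,n))·e^{i·t·k} = (n!·K!)/(N!·(n+K−N)!) · e^{i·t·(n+K−N)} · ∑_{j=0}^{min(N−n,N−K)} ((n−N)_j·(K−N)_j)/((n+K−N+1)_j · j!) · e^{i·t·j}. -/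
open Finset Nat

theorem ascPochhammer_eval_neg_mul_factorial (c j : ℕ) :
    (ascPochhammer ℂ j).eval (-((c + j : ℕ) : ℂ)) * (c ! : ℂ) = (-1) ^ j * ((c + j)! : ℂ) := by
  rw [ascPochhammer_eval_neg_eq_descPochhammer, descPochhammer_eval_eq_descFactorial, mul_assoc,
    ← Nat.cast_mul, mul_comm ((c + j).descFactorial j)]
  have h := Nat.factorial_mul_descFactorial (Nat.le_add_left j c)
  rw [Nat.add_sub_cancel] at h
  rw [h]

theorem factorial_mul_ascPochhammer_eval (m j : ℕ) :
    (m ! : ℂ) * (ascPochhammer ℂ j).eval ((m : ℂ) + 1) = ((m + j)! : ℂ) := by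
  have h := ascPochhammer_nat_eq_natCast_ascFactorial ℂ (m + 1) j
  push_cast at h
  rw [h, ← Nat.cast_mul, Nat.factorial_mul_ascFactorial]

/-- The hypergeometric mass at `m + j`, for sample size `m + (d + j)`, number of successes
`m + (c + j)` and population size `m + (c + j) + (d + j)`. -/
theorem hypergeometric_mass_eq_pochhammer (m c d j : ℕ) :
    ((m + (c + j)).choose (m + j) : ℂ) * ((d + j).choose d : ℂ) /
        ((m + (c + j) + (d + j)).choose (m + (d + j)) : ℂ)
    = ((m + (d + j))! : ℂ) * ((m + (c + j))! : ℂ) /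
        (((m + (c + j) + (d + j))! : ℂ) * (m ! : ℂ)) *
      ((ascPochhammer ℂ j).eval (-((c + j : ℕ) : ℂ)) *
          (ascPochhammer ℂ j).eval (-((d + j : ℕ) : ℂ)) /
        ((ascPochhammer ℂ j).eval ((m : ℂ) + 1) * (j ! : ℂ))) := by
  have hf : ∀ n : ℕ, (n ! : ℂ) ≠ 0 := fun n => Nat.cast_ne_zero.mpr n.factorial_ne_zero
  rw [Nat.cast_choose ℂ (by omega : m + j ≤ m + (c + j)),
    Nat.cast_choose ℂ (by omega : d ≤ d + j),
    Nat.cast_choose ℂ (by omega : m + (d + j) ≤ m + (c + j) + (d + j)),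
    show m + (c + j) - (m + j) = c by omega, show d + j - d = j by omega,
    show m + (c + j) + (d + j) - (m + (d + j)) = c + j by omega,
    eq_div_of_mul_eq (hf c) (ascPochhammer_eval_neg_mul_factorial c j),
    eq_div_of_mul_eq (hf d) (ascPochhammer_eval_neg_mul_factorial d j),
    eq_div_of_mul_eq (hf m) ((mul_comm _ _).trans (factorial_mul_ascPochhammer_eval m j))]
  have h1 : ((-1 : ℂ) ^ j) * (-1) ^ j = 1 := by rw [← mul_pow]; simp
  have := hf m
  have := hf c
  have := hf d
  have := hf j
  have := hf (c + j)
  have := hf (d + j)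
  have := hf (m + j)
  have := hf (m + (c + j))
  have := hf (m + (d + j))
  have := hf (m + (c + j) + (d + j))
  have h2 : ((-1 : ℂ) ^ j * ((c + j)! : ℂ) / (c ! : ℂ)) *
      ((-1 : ℂ) ^ j * ((d + j)! : ℂ) / (d ! : ℂ)) =
      ((c + j)! : ℂ) / (c ! : ℂ) * (((d + j)! : ℂ) / (d ! : ℂ)) := by
    linear_combination ((c + j)! : ℂ) / (c ! : ℂ) * (((d + j)! : ℂ) / (d ! : ℂ)) * h1
  rw [h2]
  field_simp

theorem hypergeometric_cf_corrected_branch (N K n : ℕ) (hKN : K ≤ N) (hnN : n ≤ N)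
    (hn : N - K + 1 ≤ n) (t : ℝ) :
    ∑ k ∈ Finset.range (n + 1),
        ((K.choose k : ℂ) * ((N - K).choose (n - k) : ℂ) / (N.choose n : ℂ)) *
          Complex.exp (Complex.I * t * k)
    = (n ! : ℂ) * (K ! : ℂ) / ((N ! : ℂ) * ((n + K - N)! : ℂ)) *
        Complex.exp (Complex.I * t * (n + K - N : ℕ)) *
      ∑ j ∈ Finset.range (min (N - n) (N - K) + 1),
        ((ascPochhammer ℂ j).eval ((n : ℂ) - (N : ℂ)) *
            (ascPochhammer ℂ j).eval ((K : ℂ) - (N : ℂ))) /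
          ((ascPochhammer ℂ j).eval ((n : ℂ) + (K : ℂ) - (N : ℂ) + 1) * (j ! : ℂ)) *
          Complex.exp (Complex.I * t * j) := by
  obtain ⟨m, a, b, rfl, rfl, rfl⟩ : ∃ m a b : ℕ, n = m + b ∧ K = m + a ∧ N = m + a + b :=
    ⟨n + K - N, N - n, N - K, by omega, by omega, by omega⟩
  rw [show m + a + b - (m + a) = b by omega, show m + a + b - (m + b) = a by omega,
    show m + b + (m + a) - (m + a + b) = m by omega,
    show ((m + b : ℕ) : ℂ) - ((m + a + b : ℕ) : ℂ) = -(a : ℂ) by push_cast; ring,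
    show ((m + a : ℕ) : ℂ) - ((m + a + b : ℕ) : ℂ) = -(b : ℂ) by push_cast; ring,
    show ((m + b : ℕ) : ℂ) + ((m + a : ℕ) : ℂ) - ((m + a + b : ℕ) : ℂ) + 1 = (m : ℂ) + 1 by
      push_cast; ring,
    add_assoc m b 1, Finset.sum_range_add, Finset.sum_eq_zero, zero_add, Finset.mul_sum]
  · symm
    apply Finset.sum_subset_zero_on_sdiff
    · exact Finset.range_subset_range.mpr (by omega)
    · intro j hj
      simp only [Finset.mem_sdiff, Finset.mem_range] at hj
      rw [Nat.choose_eq_zero_of_lt (by omega : m + a < m + j)]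
      simp
    · intro j hj
      rw [Finset.mem_range] at hj
      obtain ⟨c, rfl⟩ : ∃ c, a = c + j := ⟨a - j, by omega⟩
      obtain ⟨d, rfl⟩ : ∃ d, b = d + j := ⟨b - j, by omega⟩
      rw [show m + (d + j) - (m + j) = d by omega, hypergeometric_mass_eq_pochhammer,
        Nat.cast_add m j, mul_add, Complex.exp_add]
      ring
  · intro k hk
    rw [Finset.mem_range] at hk
    rw [Nat.choose_eq_zero_of_lt (by omega : b < m + b - k)]
    simp
end

section
/- Let N, K, n be natural numbers with 2K ≥ N, K ≤ N, and 2n ≤ N. Then for every nonzero complex number z, the probability-generating function of the hypergeometric distribution satisfies ∑_{k=0}^{n} (C(K,k)·C(N−K,n−k)/C(N,n))·z^k = ((N−n)!·K!)/(N!·(K−n)!) · z^n · ∑_{j=0}^{min(n,N−K)} ((−n)_j·(K−N)_j)/((K−n+1)_j · j!) · z^{−j}. -/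
open Finset Nat

/-- The falling product `(-(k + a))_k`, cleared of denominators. -/
theorem ascPochhammer_eval_neg_cast_add (k a : ℕ) :
    (ascPochhammer ℂ k).eval (-((k : ℂ) + (a : ℂ))) = (-1) ^ k * ((k + a)! : ℂ) / (a ! : ℂ) := by
  have ha : (a ! : ℂ) ≠ 0 := Nat.cast_ne_zero.mpr a.factorial_ne_zero
  have h := Nat.factorial_mul_descFactorial (Nat.le_add_right k a)
  rw [Nat.add_sub_cancel_left] at h
  rw [← Nat.cast_add, ascPochhammer_eval_neg_eq_descPochhammer,
    descPochhammer_eval_eq_descFactorial, ← h]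
  push_cast
  field_simp

/-- The rising product `(c + 1)_k` as a quotient of factorials. -/
theorem ascPochhammer_eval_cast_add_one (k c : ℕ) :
    (ascPochhammer ℂ k).eval ((c : ℂ) + 1) = ((c + k)! : ℂ) / (c ! : ℂ) := by
  have hc : (c ! : ℂ) ≠ 0 := Nat.cast_ne_zero.mpr c.factorial_ne_zero
  rw [← Nat.cast_add_one, ascPochhammer_nat_eq_natCast_ascFactorial,
    ← Nat.factorial_mul_ascFactorial]
  push_cast
  field_simp

/-- The hypergeometric weight of `n - j`, in terms of Pochhammer symbols. -/
theorem hypergeometric_weight_eq_ascPochhammer {N K n j : ℕ} (hKN : K ≤ N) (hnK : n ≤ K)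
    (hjn : j ≤ n) (hjM : j ≤ N - K) :
    (K.choose (n - j) : ℂ) * ((N - K).choose j : ℂ) / (N.choose n : ℂ) =
      ((N - n)! : ℂ) * (K ! : ℂ) / ((N ! : ℂ) * ((K - n)! : ℂ)) *
        (((ascPochhammer ℂ j).eval (-(n : ℂ)) * (ascPochhammer ℂ j).eval ((K : ℂ) - (N : ℂ))) /
          ((ascPochhammer ℂ j).eval ((K : ℂ) - (n : ℂ) + 1) * (j ! : ℂ))) := by
  obtain ⟨a, rfl⟩ := Nat.exists_eq_add_of_le hjn
  obtain ⟨c, rfl⟩ := Nat.exists_eq_add_of_le hnK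
  obtain ⟨m, rfl⟩ := Nat.exists_eq_add_of_le hKN
  rw [Nat.add_sub_cancel_left] at hjM
  obtain ⟨b, rfl⟩ := Nat.exists_eq_add_of_le hjM
  have e1 : (((j + a + c : ℕ) : ℂ) - ((j + a + c + (j + b) : ℕ) : ℂ)) = -((j : ℂ) + b) := by
    push_cast; ring
  have e2 : (((j + a + c : ℕ) : ℂ) - ((j + a : ℕ) : ℂ) + 1) = (c : ℂ) + 1 := by
    push_cast; ring
  rw [e1, e2, Nat.cast_add j a, ascPochhammer_eval_neg_cast_add, ascPochhammer_eval_neg_cast_add,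
    ascPochhammer_eval_cast_add_one, Nat.cast_choose ℂ (by omega), Nat.cast_choose ℂ (by omega),
    Nat.cast_choose ℂ (by omega)]
  rw [show j + a - j = a by omega, show j + a + c - a = c + j by omega,
    show j + a + c + (j + b) - (j + a + c) = j + b by omega, show j + b - j = b by omega,
    show j + a + c - (j + a) = c by omega]
  have hf (i : ℕ) : (i ! : ℂ) ≠ 0 := Nat.cast_ne_zero.mpr i.factorial_ne_zero
  have hs : ((-1 : ℂ) ^ j) * (-1) ^ j = 1 := by rw [← mul_pow]; norm_num
  have h1 := hf a
  have h2 := hf b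
  have h3 := hf c
  have h4 := hf j
  have h5 := hf (j + a)
  have h6 := hf (j + b)
  have h7 := hf (c + j)
  have h8 := hf (j + a + c)
  have h9 := hf (j + a + c + (j + b))
  have h10 := hf (j + a + c + (j + b) - (j + a))
  generalize (-1 : ℂ) ^ j = s at hs ⊢
  field_simp
  linear_combination -hs

theorem hypergeometric_pgf_symmetric_form_b (N K n : ℕ) (hK : N ≤ 2 * K) (hKN : K ≤ N)
    (hn : 2 * n ≤ N) (z : ℂ) (hz : z ≠ 0) :
    ∑ k ∈ Finset.range (n + 1),
        ((K.choose k : ℂ) * ((N - K).choose (n - k) : ℂ) / (N.choose n : ℂ)) * z ^ k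
    = ((N - n)! : ℂ) * (K ! : ℂ) / ((N ! : ℂ) * ((K - n)! : ℂ)) * z ^ n *
      ∑ j ∈ Finset.range (min n (N - K) + 1),
        ((ascPochhammer ℂ j).eval (-(n : ℂ)) * (ascPochhammer ℂ j).eval ((K : ℂ) - (N : ℂ))) /
          ((ascPochhammer ℂ j).eval ((K : ℂ) - (n : ℂ) + 1) * (j ! : ℂ)) *
          z ^ (-(j : ℤ)) := by
  rw [← Finset.sum_range_reflect, Finset.mul_sum]
  symm
  apply Finset.sum_subset_zero_on_sdiff
  · exact Finset.range_mono (by omega)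
  · intro j hj
    simp only [Finset.mem_sdiff, Finset.mem_range] at hj
    have hlt : N - K < n - (n + 1 - 1 - j) := by omega
    rw [Nat.choose_eq_zero_of_lt hlt]
    simp
  · intro j hj
    rw [Finset.mem_range] at hj
    have hjn : j ≤ n := by omega
    rw [show n + 1 - 1 - j = n - j by omega, show n - (n - j) = j by omega,
      hypergeometric_weight_eq_ascPochhammer hKN (by omega) hjn (by omega),
      pow_sub₀ z hz hjn, zpow_neg, zpow_natCast]
    ring
end

section
/- Let N, K, n be natural numbers with n ≤ K ≤ N. Then for every nonzero complex number z, the probability-generating function of the hypergeometric distribution satisfies ∑_{k=0}^{n} (C(K,k)·C(N−K,n−k)/C(N,n))·z^k = ((N−n)!·K!)/(N!·(K−n)!) · z^n · ∑_{j=0}^{min(n,N−K)} ((−n)_j·(K−N)_j)/((K−n+1)_j · j!) · z^{−j}; that is, this formula is valid on the full range n ≤ K (extending the range K ≥ N/2, n ≤ N/2). -/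
open Finset Nat

theorem ascPochhammer_eval_neg_natCast_mul_factorial {R : Type*} [CommRing R] {n j : ℕ}
    (h : j ≤ n) :
    (ascPochhammer R j).eval (-(n : R)) * ((n - j)! : R) = (-1) ^ j * (n ! : R) := by
  rw [ascPochhammer_eval_neg_eq_descPochhammer, descPochhammer_eval_eq_descFactorial,
    ← Nat.factorial_mul_descFactorial h]
  push_cast
  ring

theorem ascPochhammer_eval_natCast_add_one_mul_factorial {R : Type*} [CommRing R] (a j : ℕ) :
    (ascPochhammer R j).eval ((a : R) + 1) * (a ! : R) = ((a + j)! : R) := by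
  rw [← Nat.factorial_mul_ascFactorial, ← Nat.cast_succ, ascPochhammer_nat_eq_natCast_ascFactorial]
  push_cast
  ring

theorem hypergeometric_pgf_symmetric_form_b_extended (N K n : ℕ) (hnK : n ≤ K) (hKN : K ≤ N)
    (z : ℂ) (hz : z ≠ 0) :
    ∑ k ∈ Finset.range (n + 1),
        ((K.choose k : ℂ) * ((N - K).choose (n - k) : ℂ) / (N.choose n : ℂ)) * z ^ k
    = ((N - n)! : ℂ) * (K ! : ℂ) / ((N ! : ℂ) * ((K - n)! : ℂ)) * z ^ n *
      ∑ j ∈ Finset.range (min n (N - K) + 1),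
        ((ascPochhammer ℂ j).eval (-(n : ℂ)) * (ascPochhammer ℂ j).eval ((K : ℂ) - (N : ℂ))) /
          ((ascPochhammer ℂ j).eval ((K : ℂ) - (n : ℂ) + 1) * (j ! : ℂ)) *
          z ^ (-(j : ℤ)) := by
  have hsub : Finset.range (min n (N - K) + 1) ⊆ Finset.range (n + 1) :=
    Finset.range_subset_range.2 (by omega)
  rw [← Finset.sum_range_reflect, Finset.mul_sum]
  refine (Finset.sum_subset hsub fun j hj hj' => ?_).symm.trans
    (Finset.sum_congr rfl fun j hj => ?_)
  · rw [Finset.mem_range] at hj hj'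
    rw [Nat.choose_eq_zero_of_lt (show N - K < n - (n + 1 - 1 - j) by omega)]
    simp
  · rw [Finset.mem_range] at hj
    have hjn : j ≤ n := by omega
    have hjM : j ≤ N - K := by omega
    have fne (m : ℕ) : (m ! : ℂ) ≠ 0 := Nat.cast_ne_zero.2 (Nat.factorial_ne_zero m)
    have e₁ : n + 1 - 1 - j = n - j := by omega
    have e₂ : n - (n - j) = j := by omega
    have e₃ : K - (n - j) = K - n + j := by omega
    have c₁ : (K : ℂ) - N = -((N - K : ℕ) : ℂ) := by rw [Nat.cast_sub hKN]; ring
    have p₁ := eq_div_of_mul_eq (fne _)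
      (ascPochhammer_eval_neg_natCast_mul_factorial (R := ℂ) hjn)
    have p₂ := eq_div_of_mul_eq (fne _)
      (ascPochhammer_eval_neg_natCast_mul_factorial (R := ℂ) hjM)
    have p₃ := eq_div_of_mul_eq (fne _)
      (ascPochhammer_eval_natCast_add_one_mul_factorial (R := ℂ) (K - n) j)
    have hzj : z ^ n * z ^ (-(j : ℤ)) = z ^ (n - j) := by
      rw [zpow_neg, zpow_natCast, pow_sub₀ z hz hjn]
    have hsq : ((-1 : ℂ) ^ j) * (-1) ^ j = 1 := by rw [← mul_pow]; simp
    rw [e₁, e₂, c₁, ← Nat.cast_sub hnK, p₁, p₂, p₃,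
      Nat.cast_choose ℂ (show n - j ≤ K by omega), Nat.cast_choose ℂ hjM,
      Nat.cast_choose ℂ (hnK.trans hKN), e₃, ← hzj]
    have := fne N
    have := fne n
    have := fne K
    have := fne j
    have := fne (N - n)
    have := fne (K - n)
    have := fne (n - j)
    have := fne (N - K - j)
    have := fne (K - n + j)
    generalize z ^ (-(j : ℤ)) = w
    generalize z ^ n = v
    generalize (-1 : ℂ) ^ j = s at hsq
    field_simp
    linear_combination (-(((N - K)! : ℂ) * v * w)) * hsq
end

section
/- Let m be a natural number and z a complex number with z ≠ 1. Then ∑_{j=0}^{m} C(m,j)^2 · z^j = (z−1)^m · ∑_{j=0}^{m} ((−m)_j · (m+1)_j)/(j!)^2 · (1−z)^{−j}. (The left-hand side equals the terminating hypergeometric sum ₂F₁(−m,−m;1;z), since (−m)_j·(−m)_j/(j!)^2 = C(m,j)^2; the right-hand side is (z−1)^m · P_m((z+1)/(z−1)) where P_m is the m-th Legendre polynomial.) -/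
open Finset Nat

theorem choose_mul_choose_eq_choose_mul_choose_sub {m k i : ℕ} (hk : k ≤ m) (hi : i ≤ m) :
    m.choose k * k.choose i = m.choose i * (m - i).choose (m - k) := by
  rcases le_or_gt i k with h | h
  · rw [Nat.choose_mul h, ← Nat.choose_symm (show k - i ≤ m - i by omega)]
    congr 2
    omega
  · rw [Nat.choose_eq_zero_of_lt h, Nat.choose_eq_zero_of_lt (show m - i < m - k by omega),
      mul_zero, mul_zero]

theorem sum_choose_sq_mul_choose {m i : ℕ} (hi : i ≤ m) :
    ∑ k ∈ Finset.range (m + 1), m.choose k ^ 2 * k.choose i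
      = m.choose i * (m + (m - i)).choose m := by
  rw [Nat.add_choose_eq, Finset.Nat.sum_antidiagonal_eq_sum_range_succ_mk, Finset.mul_sum]
  refine Finset.sum_congr rfl fun k hk => ?_
  have hk' : k ≤ m := Nat.lt_succ_iff.mp (Finset.mem_range.mp hk)
  rw [sq, mul_assoc, choose_mul_choose_eq_choose_mul_choose_sub hk' hi]
  ring

theorem sum_choose_sq_mul_one_add_pow {R : Type*} [CommSemiring R] (m : ℕ) (w : R) :
    ∑ k ∈ Finset.range (m + 1), (m.choose k : R) ^ 2 * (w + 1) ^ k
      = ∑ j ∈ Finset.range (m + 1), (m.choose j : R) * ((m + j).choose m : R) * w ^ (m - j) := by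
  have expand : ∀ k ∈ Finset.range (m + 1), (m.choose k : R) ^ 2 * (w + 1) ^ k
      = ∑ i ∈ Finset.range (m + 1), ((m.choose k ^ 2 * k.choose i : ℕ) : R) * w ^ i := by
    intro k hk
    rw [add_pow, Finset.mul_sum]
    refine Finset.sum_subset_zero_on_sdiff
      (Finset.range_subset_range.mpr (Nat.succ_le_of_lt (Finset.mem_range.mp hk))) ?_ ?_
    · intro i hi
      have hki : k < i := by simp at hi; omega
      simp [Nat.choose_eq_zero_of_lt hki]
    · intro i _
      push_cast
      ring
  rw [Finset.sum_congr rfl expand, Finset.sum_comm,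
    ← Finset.sum_range_reflect (fun j => (m.choose j : R) * ((m + j).choose m : R) * w ^ (m - j))]
  refine Finset.sum_congr rfl fun i hi => ?_
  have hi' : i ≤ m := Nat.lt_succ_iff.mp (Finset.mem_range.mp hi)
  rw [← Finset.sum_mul, ← Nat.cast_sum, sum_choose_sq_mul_choose hi', add_tsub_cancel_right,
    Nat.choose_symm hi', Nat.sub_sub_self hi', Nat.cast_mul]

theorem ascPochhammer_eval_neg_mul_eval_add_one (m j : ℕ) :
    (ascPochhammer ℂ j).eval (-(m : ℂ)) * (ascPochhammer ℂ j).eval ((m : ℂ) + 1)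
      = (-1) ^ j * ((j ! : ℂ) ^ 2) * (m.choose j * (m + j).choose m) := by
  have h : (ascPochhammer ℂ j).eval ((m : ℂ) + 1) = (j ! : ℂ) * (m + j).choose m := by
    rw [← Nat.cast_add_one, ← ascPochhammer_eval_cast, ascPochhammer_nat_eq_ascFactorial,
      Nat.ascFactorial_eq_factorial_mul_choose, Nat.choose_symm_add, Nat.cast_mul]
  rw [h, ascPochhammer_eval_neg_eq_descPochhammer, descPochhammer_eval_eq_descFactorial,
    Nat.descFactorial_eq_factorial_mul_choose, Nat.cast_mul]
  ring

theorem central_hypergeometric_legendre_identity (m : ℕ) (z : ℂ) (hz : z ≠ 1) :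
    ∑ j ∈ Finset.range (m + 1), ((m.choose j : ℂ)) ^ 2 * z ^ j
    = (z - 1) ^ m *
      ∑ j ∈ Finset.range (m + 1),
        ((ascPochhammer ℂ j).eval (-(m : ℂ)) * (ascPochhammer ℂ j).eval ((m : ℂ) + 1)) /
          ((j ! : ℂ) ^ 2) * (1 - z) ^ (-(j : ℤ)) := by
  have hw : z - 1 ≠ 0 := sub_ne_zero.mpr hz
  have key := sum_choose_sq_mul_one_add_pow m (z - 1)
  rw [sub_add_cancel] at key
  rw [key, Finset.mul_sum]
  refine Finset.sum_congr rfl fun j hj => ?_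
  have hj' : j ≤ m := Nat.lt_succ_iff.mp (Finset.mem_range.mp hj)
  have hf : (j ! : ℂ) ≠ 0 := Nat.cast_ne_zero.mpr (Nat.factorial_ne_zero j)
  have hneg : (1 - z) ^ j = (-1) ^ j * (z - 1) ^ j := by rw [← mul_pow]; ring
  have hs : ((-1 : ℂ)) ^ j ≠ 0 := pow_ne_zero _ (by norm_num)
  rw [ascPochhammer_eval_neg_mul_eval_add_one, zpow_neg, zpow_natCast, hneg,
    pow_sub₀ _ hw hj']
  field_simp
end
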